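/- arXiv:1307.2347 — 2 statements merged into one kernel-verified Lean document; each statement's English description precedes it below -/
import Mathlib

section
/- Fix n ≥ 1 and 0 < δ < 1, and suppose ã(n,k) is defined recursively by ã(k,k) = 1 and ã(n,k) = fl(C(n,k)) ⊗ ⊕_{s=1}^{n-k} ( fl((2^k-1)^s) ⊗ 2^{k(n-k-s)} ⊗ ã(n-k,s) ), where each floating-point operation ⊕, ⊗ and the representation fl incur relative error at most a multiplicative factor between (1-δ) and 1 (i.e., (1-δ)(a+b) ≤ a⊕b ≤ a+b, (1-δ)ab ≤ a⊗b ≤ ab, (1-δ)x ≤ fl(x) ≤ x). Then for all 1 ≤ k ≤ n, (1-δ)^(3n²) · a(n,k) ≤ ã(n,k) ≤ a(n,k). -/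
/-- A relation is acyclic if there is no directed cycle. -/
def IsAcyclicRel {V : Type*} (r : V → V → Prop) : Prop :=
  ∀ v, ¬ Relation.TransGen r v v

/-- The number of labeled DAGs on vertex set `Fin n` having exactly `k` sources. -/
noncomputable def dagCount (n k : ℕ) : ℕ :=
  Nat.card {r : Fin n → Fin n → Prop //
    IsAcyclicRel r ∧ Nat.card {v : Fin n // ∀ u, ¬ r u v} = k}


lemma acyc_comap {V W : Type*} (e : W → V) (r : V → V → Prop) (h : IsAcyclicRel r) :
    IsAcyclicRel (fun a b => r (e a) (e b)) := by
  intro v hv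
  exact h (e v) (Relation.TransGen.lift (p := r) e (fun _ _ h => h) _ _ hv)

lemma acyc_exists_source {V : Type*} [Finite V] [Nonempty V] (r : V → V → Prop)
    (h : IsAcyclicRel r) : ∃ v, ∀ u, ¬ r u v := by
  have : Std.Irrefl (Relation.TransGen r) := ⟨h⟩
  have : IsTrans V (Relation.TransGen r) := ⟨fun _ _ _ => Relation.TransGen.trans⟩
  have wf : WellFounded (Relation.TransGen r) := Finite.wellFounded_of_trans_of_irrefl _
  obtain ⟨v, -, hv⟩ := wf.has_min Set.univ Set.univ_nonempty
  exact ⟨v, fun u hu => hv u trivial (Relation.TransGen.single hu)⟩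

/-- glue a relation on `β` with arrows from `α`. -/
def glue {α β : Type*} (q : β → β → Prop) (f : β → α → Prop) : α ⊕ β → α ⊕ β → Prop
  | Sum.inl a, Sum.inr b => f b a
  | Sum.inr a, Sum.inr b => q a b
  | _, Sum.inl _ => False

lemma glue_to_inl {α β : Type*} (q : β → β → Prop) (f : β → α → Prop) (x : α ⊕ β) (a : α) :
    ¬ glue q f x (Sum.inl a) := by
  cases x <;> simp [glue]

lemma glue_trans {α β : Type*} (q : β → β → Prop) (f : β → α → Prop) (b : β) (y : α ⊕ β)
    (h : Relation.TransGen (glue q f) (Sum.inr b) y) :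
    ∃ c, y = Sum.inr c ∧ Relation.TransGen q b c := by
  induction h with
  | @single y h =>
    cases y with
    | inl a => exact absurd h (glue_to_inl _ _ _ _)
    | inr c => exact ⟨c, rfl, .single h⟩
  | @tail y z _ h ih =>
    obtain ⟨c, rfl, hc⟩ := ih
    cases z with
    | inl a => exact absurd h (glue_to_inl _ _ _ _)
    | inr d => exact ⟨d, rfl, hc.tail h⟩

lemma glue_acyc {α β : Type*} (q : β → β → Prop) (f : β → α → Prop) (h : IsAcyclicRel q) :
    IsAcyclicRel (glue q f) := by
  intro v hv
  cases v with
  | inl a =>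
    obtain ⟨y, -, hy⟩ := Relation.TransGen.tail'_iff.1 hv
    exact glue_to_inl _ _ _ _ hy
  | inr b =>
    obtain ⟨c, hc, hq⟩ := glue_trans q f b _ hv
    cases hc
    exact h b hq

/-- decomposition of DAGs with prescribed sources -/
def glueEquiv (α β : Type*) :
    {r : α ⊕ β → α ⊕ β → Prop // IsAcyclicRel r ∧ ∀ v, (∀ u, ¬ r u v) ↔ v.isLeft} ≃
    Σ q : {q : β → β → Prop // IsAcyclicRel q},
      ∀ b : β, {g : α → Prop // (∀ u, ¬ q.1 u b) → ∃ a, g a} where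
  toFun r := ⟨⟨fun a b => r.1 (Sum.inr a) (Sum.inr b), acyc_comap Sum.inr r.1 r.2.1⟩,
    fun b => ⟨fun a => r.1 (Sum.inl a) (Sum.inr b), by
      intro h
      by_contra! hc
      have := (r.2.2 (Sum.inr b)).1 (by rintro (a | a); exacts [hc a, h a])
      simp at this⟩⟩
  invFun x := ⟨glue x.1.1 (fun b => (x.2 b).1), glue_acyc _ _ x.1.2, by
    rintro (a | b)
    · simp [glue_to_inl]
    · simp only [Sum.isLeft_inr, Bool.false_eq_true, iff_false]
      intro h
      obtain ⟨a, ha⟩ := (x.2 b).2 (fun u => h (Sum.inr u))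
      exact h (Sum.inl a) ha⟩
  left_inv r := by
    apply Subtype.ext
    funext x y
    cases y with
    | inl a =>
      have h := (r.2.2 (Sum.inl a)).2 rfl x
      simp only [eq_iff_iff]
      exact ⟨fun h' => absurd h' (glue_to_inl _ _ _ _), fun h' => absurd h' h⟩
    | inr b => cases x <;> rfl
  right_inv x := rfl

lemma card_nonempty_sets (k : ℕ) (P : Prop) [Decidable P] :
    Nat.card {g : Fin k → Prop // P → ∃ a, g a} = if P then 2 ^ k - 1 else 2 ^ k := by
  classical
  have hc : Fintype.card (Fin k → Prop) = 2 ^ k := by simp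
  split_ifs with h
  · rw [← hc, Nat.card_eq_fintype_card]
    have : Fintype.card {g : Fin k → Prop // g = fun _ => False} = 1 := by simp
    rw [← this, ← Fintype.card_subtype_compl]
    apply Fintype.card_congr
    apply Equiv.subtypeEquivRight
    intro g
    simp [h, funext_iff]
  · rw [← hc, Nat.card_eq_fintype_card, Fintype.card_subtype]
    simp [h]

lemma card_fib (k j : ℕ) (q : Fin j → Fin j → Prop) :
    Nat.card (∀ b : Fin j, {g : Fin k → Prop // (∀ u, ¬ q u b) → ∃ a, g a}) =
      (2 ^ k - 1) ^ Nat.card {v : Fin j // ∀ u, ¬ q u v} *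
        2 ^ (k * (j - Nat.card {v : Fin j // ∀ u, ¬ q u v})) := by
  classical
  rw [Nat.card_pi]
  simp_rw [card_nonempty_sets]
  rw [Finset.prod_ite, Finset.prod_const, Finset.prod_const, pow_mul,
    Nat.card_eq_fintype_card, Fintype.card_subtype]
  congr 2
  have := Finset.card_filter_add_card_filter_not (s := (Finset.univ : Finset (Fin j)))
    (fun v => ∀ u, ¬ q u v)
  simp only [Finset.card_univ, Fintype.card_fin] at this
  omega

lemma card_glue (k j : ℕ) (hj : 1 ≤ j) :
    Nat.card {r : Fin k ⊕ Fin j → Fin k ⊕ Fin j → Prop //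
        IsAcyclicRel r ∧ ∀ v, (∀ u, ¬ r u v) ↔ v.isLeft} =
      ∑ s ∈ Finset.Icc 1 j, (2 ^ k - 1) ^ s * (2 ^ (k * (j - s)) * dagCount j s) := by
  classical
  rw [Nat.card_congr (glueEquiv _ _), Nat.card_sigma]
  simp_rw [card_fib]
  have hmaps : ∀ q ∈ (Finset.univ : Finset {q : Fin j → Fin j → Prop // IsAcyclicRel q}),
      Nat.card {v : Fin j // ∀ u, ¬ q.1 u v} ∈ Finset.Icc 1 j := by
    intro q _
    have : Nonempty (Fin j) := ⟨⟨0, hj⟩⟩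
    obtain ⟨v, hv⟩ := acyc_exists_source q.1 q.2
    have : Nonempty {v : Fin j // ∀ u, ¬ q.1 u v} := ⟨⟨v, hv⟩⟩
    rw [Finset.mem_Icc]
    refine ⟨Nat.card_pos, ?_⟩
    calc _ ≤ Nat.card (Fin j) := Nat.card_le_card_of_injective _ Subtype.val_injective
      _ = j := by simp
  rw [← Finset.sum_fiberwise_of_maps_to hmaps]
  apply Finset.sum_congr rfl
  intro s _
  rw [Finset.sum_congr rfl (g := fun _ => (2 ^ k - 1) ^ s * 2 ^ (k * (j - s)))]
  · rw [Finset.sum_const, smul_eq_mul, mul_comm, mul_assoc]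
    congr 2
    rw [dagCount, ← Nat.card_congr (Equiv.subtypeSubtypeEquivSubtypeInter
      (fun r : Fin j → Fin j → Prop => IsAcyclicRel r)
      (fun r => Nat.card {v : Fin j // ∀ u, ¬ r u v} = s)),
      Nat.card_eq_fintype_card, Fintype.card_subtype]
  · intro q hq
    rw [(Finset.mem_filter.1 hq).2]

/-- transport along an equivalence -/
def transEquiv {V W : Type*} (e : W ≃ V) (p : V → Prop) (p' : W → Prop)
    (h : ∀ w, p (e w) ↔ p' w) :
    {r : V → V → Prop // IsAcyclicRel r ∧ ∀ v, (∀ u, ¬ r u v) ↔ p v} ≃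
    {r : W → W → Prop // IsAcyclicRel r ∧ ∀ v, (∀ u, ¬ r u v) ↔ p' v} where
  toFun r := ⟨fun a b => r.1 (e a) (e b), acyc_comap e r.1 r.2.1, fun v => by
    rw [← h, ← r.2.2, e.forall_congr_left]; simp⟩
  invFun r := ⟨fun a b => r.1 (e.symm a) (e.symm b), acyc_comap e.symm r.1 r.2.1, fun v => by
    rw [← e.apply_symm_apply v, h, ← r.2.2, e.symm.forall_congr_left]; simp⟩
  left_inv r := by simp
  right_inv r := by simp

/-- split according to source set -/
noncomputable def splitEquiv (m k : ℕ) :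
    {r : Fin m → Fin m → Prop //
      IsAcyclicRel r ∧ Nat.card {v : Fin m // ∀ u, ¬ r u v} = k} ≃
    Σ S : {S : Finset (Fin m) // S.card = k},
      {r : Fin m → Fin m → Prop // IsAcyclicRel r ∧ ∀ v, (∀ u, ¬ r u v) ↔ v ∈ S.1} := by
  classical
  refine
  { toFun := fun r => ⟨⟨Finset.univ.filter (fun v => ∀ u, ¬ r.1 u v), by
      refine Eq.trans ?_ r.2.2
      rw [Nat.card_eq_fintype_card, Fintype.card_subtype]⟩, r.1, r.2.1, by simp⟩
    invFun := fun x => ⟨x.2.1, x.2.2.1, by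
      simp_rw [x.2.2.2]
      rw [Nat.card_eq_fintype_card, Fintype.card_coe, x.1.2]⟩
    left_inv := fun r => rfl
    right_inv := ?_ }
  rintro ⟨⟨S, hS⟩, ⟨r, hr, h⟩⟩
  have : S = Finset.univ.filter (fun v => ∀ u, ¬ r u v) := by
    ext v; simp [← h]
  subst this
  rfl

lemma dagCount_rec (m k : ℕ) (hkm : k < m) :
    dagCount m k = m.choose k * ∑ s ∈ Finset.Icc 1 (m - k),
      (2 ^ k - 1) ^ s * (2 ^ (k * (m - k - s)) * dagCount (m - k) s) := by
  classical
  rw [dagCount, Nat.card_congr (splitEquiv m k), Nat.card_sigma]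
  rw [Finset.sum_congr rfl (g := fun _ => ∑ s ∈ Finset.Icc 1 (m - k),
      (2 ^ k - 1) ^ s * (2 ^ (k * (m - k - s)) * dagCount (m - k) s))]
  · rw [Finset.sum_const, smul_eq_mul, Finset.card_univ, Fintype.card_finset_len,
      Fintype.card_fin]
  · rintro ⟨S, hS⟩ -
    have hS' : Sᶜ.card = m - k := by rw [Finset.card_compl, hS, Fintype.card_fin]
    rw [← card_glue k (m - k) (by omega)]
    apply Nat.card_congr
    apply transEquiv (finSumEquivOfFinset hS hS')
    rintro (a | b)
    · simp
    · have := Finset.orderEmbOfFin_mem Sᶜ hS' b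
      rw [Finset.mem_compl] at this
      simpa only [finSumEquivOfFinset_inr, Sum.isLeft_inr, Bool.false_eq_true, iff_false] using this

lemma dagCount_self (k : ℕ) : dagCount k k = 1 := by
  classical
  rw [dagCount, Nat.card_eq_one_iff_unique]
  have key : ∀ r : Fin k → Fin k → Prop, Nat.card {v : Fin k // ∀ u, ¬ r u v} = k →
      r = fun _ _ => False := by
    intro r h
    rw [Nat.card_eq_fintype_card, Fintype.card_subtype] at h
    have := Finset.eq_univ_of_card _ (h.trans (Fintype.card_fin k).symm)
    funext u v
    have hv := Finset.mem_univ v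
    rw [← this] at hv
    simpa using (Finset.mem_filter.1 hv).2 u
  refine ⟨⟨fun a b => Subtype.ext ((key _ a.2.2).trans (key _ b.2.2).symm)⟩,
    ⟨⟨fun _ _ => False, ?_, by simp⟩⟩⟩
  intro v hv
  obtain ⟨_, -, h⟩ := Relation.TransGen.tail'_iff.1 hv
  exact h

lemma fold_bound (δ : ℝ) (hδ0 : 0 ≤ δ) (hδ1 : δ < 1) (oplus : ℝ → ℝ → ℝ)
    (hop : ∀ a b : ℝ, 0 ≤ a → 0 ≤ b → (1 - δ) * (a + b) ≤ oplus a b ∧ oplus a b ≤ a + b)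
    (c : ℝ) (hc : 0 ≤ c) (f g : ℕ → ℝ) (l : List ℕ)
    (h : ∀ s ∈ l, 0 ≤ g s ∧ c * g s ≤ f s ∧ f s ≤ g s) :
    0 ≤ (l.map g).sum ∧ (1 - δ) ^ l.length * (c * (l.map g).sum) ≤ (l.map f).foldr oplus 0 ∧
      (l.map f).foldr oplus 0 ≤ (l.map g).sum := by
  have hd : 0 ≤ 1 - δ := by linarith
  induction l with
  | nil => simp
  | cons a l ih =>
    obtain ⟨i0, i1, i2⟩ := ih (fun s hs => h s (List.mem_cons_of_mem _ hs))
    obtain ⟨g0, g1, g2⟩ := h a List.mem_cons_self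
    simp only [List.map_cons, List.foldr_cons, List.sum_cons, List.length_cons]
    have hcg := mul_nonneg hc g0
    have hp : 0 ≤ (1 - δ) ^ l.length := pow_nonneg hd _
    have hp1 : (1 - δ) ^ l.length ≤ 1 := pow_le_one₀ hd (by linarith)
    obtain ⟨o1, o2⟩ := hop (f a) ((l.map f).foldr oplus 0) (by linarith)
      (le_trans (mul_nonneg hp (mul_nonneg hc i0)) i1)
    refine ⟨by linarith, le_trans ?_ o1, by linarith⟩
    rw [pow_succ', mul_assoc]
    apply mul_le_mul_of_nonneg_left _ hd
    have : (1 - δ) ^ l.length * (c * g a) ≤ c * g a := mul_le_of_le_one_left hcg hp1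
    linarith

lemma otimes_bound (δ : ℝ) (hδ1 : δ < 1) (otimes : ℝ → ℝ → ℝ)
    (hot : ∀ a b : ℝ, 0 ≤ a → 0 ≤ b → (1 - δ) * (a * b) ≤ otimes a b ∧ otimes a b ≤ a * b)
    (p q : ℕ) (x y x' y' : ℝ) (hx : 0 ≤ x) (hy : 0 ≤ y)
    (h1 : (1 - δ) ^ p * x ≤ x') (h2 : x' ≤ x) (h3 : (1 - δ) ^ q * y ≤ y') (h4 : y' ≤ y) :
    (1 - δ) ^ (p + q + 1) * (x * y) ≤ otimes x' y' ∧ otimes x' y' ≤ x * y := by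
  have hd : 0 ≤ 1 - δ := by linarith
  have hx1 : 0 ≤ (1 - δ) ^ p * x := by positivity
  have hy1 : 0 ≤ (1 - δ) ^ q * y := by positivity
  have hx' := hx1.trans h1
  have hy' := hy1.trans h3
  obtain ⟨o1, o2⟩ := hot x' y' hx' hy'
  refine ⟨le_trans ?_ o1, o2.trans (mul_le_mul h2 h4 hy' hx)⟩
  calc (1 - δ) ^ (p + q + 1) * (x * y)
      = (1 - δ) * (((1 - δ) ^ p * x) * ((1 - δ) ^ q * y)) := by ring
    _ ≤ _ := mul_le_mul_of_nonneg_left (mul_le_mul h1 h3 hy1 hx') hd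

/-- If the table `ã(m,k)` is computed by the floating-point version of Robinson's
recurrence, where each floating-point operation incurs a multiplicative error
between `1-δ` and `1`, then `(1-δ)^(3n²)·a(n,k) ≤ ã(n,k) ≤ a(n,k)`. -/
theorem stmt_7 (n : ℕ) (hn : 1 ≤ n) (δ : ℝ) (hδ0 : 0 ≤ δ) (hδ1 : δ < 1)
    (fl : ℝ → ℝ) (oplus otimes : ℝ → ℝ → ℝ)
    (hfl : ∀ x : ℝ, 0 ≤ x → (1 - δ) * x ≤ fl x ∧ fl x ≤ x)
    (hop : ∀ a b : ℝ, 0 ≤ a → 0 ≤ b → (1 - δ) * (a + b) ≤ oplus a b ∧ oplus a b ≤ a + b)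
    (hot : ∀ a b : ℝ, 0 ≤ a → 0 ≤ b → (1 - δ) * (a * b) ≤ otimes a b ∧ otimes a b ≤ a * b)
    (atil : ℕ → ℕ → ℝ)
    (hbase : ∀ k, atil k k = 1)
    (hrec : ∀ m k, 1 ≤ k → k < m → m ≤ n →
      atil m k =
        otimes (fl ((m.choose k : ℕ) : ℝ))
          (((List.range' 1 (m - k)).map (fun s =>
              otimes (fl ((((2 ^ k - 1) ^ s : ℕ) : ℝ)))
                (otimes ((2 : ℝ) ^ (k * (m - k - s))) (atil (m - k) s)))).foldr oplus 0))
    (k : ℕ) (h1 : 1 ≤ k) (h2 : k ≤ n) :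
    (1 - δ) ^ (3 * n ^ 2) * (dagCount n k : ℝ) ≤ atil n k ∧
      atil n k ≤ (dagCount n k : ℝ) := by
  have hd : 0 ≤ 1 - δ := by linarith
  have hd1 : 1 - δ ≤ 1 := by linarith
  suffices H : ∀ m, m ≤ n → ∀ k, 1 ≤ k → k ≤ m →
      (1 - δ) ^ (3 * m ^ 2) * (dagCount m k : ℝ) ≤ atil m k ∧
      atil m k ≤ (dagCount m k : ℝ) from H n le_rfl k h1 h2
  intro m
  induction m using Nat.strong_induction_on with
  | _ m ih =>
  intro hm k hk hkm
  rcases hkm.eq_or_lt with rfl | hlt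
  · rw [hbase, dagCount_self]
    simpa using pow_le_one₀ hd hd1
  rw [hrec m k hk hlt hm]
  set j := m - k with hj
  have hsum : ∀ (g : ℕ → ℝ), ((List.range' 1 j).map g).sum = ∑ s ∈ Finset.Icc 1 j, g s := by
    intro g
    have : Finset.Icc 1 j = (List.range' 1 j).toFinset := by
      ext x; simp [List.mem_range'_1]; omega
    rw [this, List.sum_toFinset _ List.nodup_range']
  have hfold := fold_bound δ hδ0 hδ1 oplus hop ((1 - δ) ^ (3 * j ^ 2 + 3)) (by positivity)
    (fun s => otimes (fl ((((2 ^ k - 1) ^ s : ℕ) : ℝ)))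
                (otimes ((2 : ℝ) ^ (k * (j - s))) (atil j s)))
    (fun s => (((2 ^ k - 1) ^ s : ℕ) : ℝ) * ((2 : ℝ) ^ (k * (j - s)) * (dagCount j s : ℝ)))
    (List.range' 1 j) (by
      intro s hs
      rw [List.mem_range'_1] at hs
      refine ⟨by positivity, ?_⟩
      obtain ⟨i1, i2⟩ := ih j (by omega) (by omega) s hs.1 (by omega)
      obtain ⟨a1, a2⟩ := otimes_bound δ hδ1 otimes hot 0 (3 * j ^ 2)
        ((2 : ℝ) ^ (k * (j - s))) (dagCount j s) _ _ (by positivity) (by positivity)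
        (by rw [pow_zero, one_mul]) le_rfl i1 i2
      obtain ⟨f1, f2⟩ := hfl (((2 ^ k - 1) ^ s : ℕ) : ℝ) (by positivity)
      have := otimes_bound δ hδ1 otimes hot 1 _ _ _ _ _ (by positivity) (by positivity)
        (by rw [pow_one]; exact f1) f2 a1 a2
      rwa [show 1 + (0 + 3 * j ^ 2 + 1) + 1 = 3 * j ^ 2 + 3 by ring] at this)
  obtain ⟨s0, s1, s2⟩ := hfold
  rw [← mul_assoc, ← pow_add, List.length_range'] at s1
  obtain ⟨f1, f2⟩ := hfl ((m.choose k : ℕ) : ℝ) (by positivity)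
  obtain ⟨t1, t2⟩ := otimes_bound δ hδ1 otimes hot 1 _ _ _ _ _ (by positivity) s0
        (by rw [pow_one]; exact f1) f2 s1 s2
  have hD : (dagCount m k : ℝ) = (m.choose k : ℝ) * ((List.range' 1 j).map
      (fun s => (((2 ^ k - 1) ^ s : ℕ) : ℝ) *
        ((2 : ℝ) ^ (k * (j - s)) * (dagCount j s : ℝ)))).sum := by
    rw [hsum, dagCount_rec m k hlt, Nat.cast_mul, Nat.cast_sum]
    congr 1
    apply Finset.sum_congr rfl
    intro s _
    rw [Nat.cast_mul, Nat.cast_mul]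
    congr 2
    rw [Nat.cast_pow, Nat.cast_ofNat]
  rw [← hD] at t1 t2
  refine ⟨le_trans (mul_le_mul_of_nonneg_right ?_ (Nat.cast_nonneg _)) t1, t2⟩
  apply pow_le_pow_of_le_one hd hd1
  have hmj : m = j + k := by omega
  have hj1 : 1 ≤ j := by omega
  rw [hmj]
  nlinarith [Nat.mul_le_mul hj1 hk, Nat.mul_le_mul_left j hk, Nat.mul_le_mul hk hk]
end

section
/- The number d(n,k) of labeled essential DAGs on n vertices with exactly k vertices of maximum depth satisfies d(n,n) = 1 and, for 1 ≤ k < n, d(n,k) = C(n,k) · Σ_{s=1}^{n-k} d(n-k,s) · ( s·(2^{n-k-s} - 1) + (2^s - s - 1)·2^{n-k-s} )^k. -/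
/-- An essential DAG: for every arc `(u,v)`, `N⁻(u) ≠ N⁻(v) \ {u}`. -/
def IsEssential {V : Type*} (r : V → V → Prop) : Prop :=
  ∀ u v, r u v → ∃ x, ¬ (r x u ↔ (r x v ∧ x ≠ u))

/-- The depth of `x`: the number of arcs of a longest directed path from a source to `x`
(`0` if `x` is itself a source). -/
noncomputable def vertexDepth {n : ℕ} (r : Fin n → Fin n → Prop) (x : Fin n) : ℕ :=
  sSup {k : ℕ | ∃ l : List (Fin n), l.Chain' r ∧ l.getLast? = some x ∧
    (∃ v : Fin n, l.head? = some v ∧ ∀ u, ¬ r u v) ∧ l.length = k + 1}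

/-- The number of labeled essential DAGs on `Fin n` with exactly `k` vertices of
maximum depth. -/
noncomputable def essCount (n k : ℕ) : ℕ :=
  Nat.card {r : Fin n → Fin n → Prop //
    IsAcyclicRel r ∧ IsEssential r ∧
      Nat.card {x : Fin n // ∀ y, vertexDepth r y ≤ vertexDepth r x} = k}

section Helpers

open Finset Classical

/-- Recursive characterization of the depth function. -/
def EDepth {V : Type} (r : V → V → Prop) (d : V → ℕ) : Prop :=
  (∀ u v, r u v → d u < d v) ∧ (∀ v m, d v = m + 1 → ∃ u, r u v ∧ d u = m)

theorem EDepth.acyclic {V : Type} {r : V → V → Prop} {d : V → ℕ} (h : EDepth r d) :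
    IsAcyclicRel r := by
  have key : ∀ u v, Relation.TransGen r u v → d u < d v := by
    intro u v huv
    induction huv with
    | single h' => exact h.1 _ _ h'
    | tail _ h' ih => exact ih.trans (h.1 _ _ h')
  intro v hv
  exact lt_irrefl _ (key v v hv)

theorem EDepth.le {V : Type} {r : V → V → Prop} {d d' : V → ℕ} (h : EDepth r d)
    (h' : EDepth r d') : ∀ m v, d v = m → m ≤ d' v := by
  intro m
  induction m with
  | zero => intro v _; omega
  | succ m ih =>
    intro v hv
    obtain ⟨u, hu, hd⟩ := h.2 v m hv
    have := ih u hd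
    have := h'.1 u v hu
    omega

theorem EDepth.unique {V : Type} {r : V → V → Prop} {d d' : V → ℕ} (h : EDepth r d)
    (h' : EDepth r d') : d = d' := by
  funext v
  exact le_antisymm (h.le h' _ v rfl) (h'.le h _ v rfl)

theorem acyclic_wf {n : ℕ} {r : Fin n → Fin n → Prop} (h : IsAcyclicRel r) : WellFounded r := by
  have : Std.Irrefl (Relation.TransGen r) := ⟨h⟩
  have : IsTrans (Fin n) (Relation.TransGen r) := ⟨fun _ _ _ => Relation.TransGen.trans⟩
  have := Finite.wellFounded_of_trans_of_irrefl (Relation.TransGen r)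
  exact Subrelation.wf (fun h => Relation.TransGen.single h) this

theorem acyclic_len {n : ℕ} {r : Fin n → Fin n → Prop} (h : IsAcyclicRel r) (l : List (Fin n))
    (hl : l.IsChain r) : l.length ≤ n := by
  have h1 : l.IsChain (Relation.TransGen r) := hl.imp (fun _ _ h => Relation.TransGen.single h)
  have : IsTrans (Fin n) (Relation.TransGen r) := ⟨fun _ _ _ => Relation.TransGen.trans⟩
  have h2 : l.Pairwise (Relation.TransGen r) := List.isChain_iff_pairwise.1 h1
  have h3 : l.Nodup := by
    refine h2.imp ?_
    rintro a b hab rfl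
    exact h a hab
  simpa using h3.length_le_card

/-- The set whose supremum is the depth. -/
def dset {n : ℕ} (r : Fin n → Fin n → Prop) (x : Fin n) : Set ℕ :=
  {k : ℕ | ∃ l : List (Fin n), l.IsChain r ∧ l.getLast? = some x ∧
    (∃ v : Fin n, l.head? = some v ∧ ∀ u, ¬ r u v) ∧ l.length = k + 1}

theorem dset_bdd {n : ℕ} {r : Fin n → Fin n → Prop} (h : IsAcyclicRel r) (x : Fin n) :
    BddAbove (dset r x) := by
  refine ⟨n, ?_⟩
  rintro k ⟨l, hl, -, -, hk⟩
  have := acyclic_len h l hl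
  omega

theorem dset_step {n : ℕ} {r : Fin n → Fin n → Prop} {u v : Fin n} (huv : r u v) {k : ℕ}
    (hk : k ∈ dset r u) : k + 1 ∈ dset r v := by
  obtain ⟨l, hl, hu, ⟨w, hw, hw'⟩, hk⟩ := hk
  refine ⟨l ++ [v], ?_, by simp, ⟨w, ?_, hw'⟩, by simp [hk]⟩
  · rw [List.isChain_append]
    refine ⟨hl, by simp, ?_⟩
    intro x hx y hy
    simp [hu] at hx hy
    subst hx; subst hy; exact huv
  · simp [List.head?_append, hw]

theorem dset_nonempty {n : ℕ} {r : Fin n → Fin n → Prop} (h : IsAcyclicRel r) (x : Fin n) :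
    (dset r x).Nonempty := by
  induction x using (acyclic_wf h).induction with
  | _ x ih =>
    by_cases hx : ∃ u, r u x
    · obtain ⟨u, hu⟩ := hx
      obtain ⟨k, hk⟩ := ih u hu
      exact ⟨k + 1, dset_step hu hk⟩
    · push Not at hx
      exact ⟨0, [x], by simp, by simp, ⟨x, by simp, hx⟩, by simp⟩

theorem vertexDepth_mem {n : ℕ} {r : Fin n → Fin n → Prop} (h : IsAcyclicRel r) (x : Fin n) :
    vertexDepth r x ∈ dset r x := Nat.sSup_mem (dset_nonempty h x) (dset_bdd h x)

theorem le_vertexDepth {n : ℕ} {r : Fin n → Fin n → Prop} (h : IsAcyclicRel r) (x : Fin n)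
    {k : ℕ} (hk : k ∈ dset r x) : k ≤ vertexDepth r x := le_csSup (dset_bdd h x) hk

theorem vertexDepth_spec {n : ℕ} {r : Fin n → Fin n → Prop} (h : IsAcyclicRel r) :
    EDepth r (vertexDepth r) := by
  have ha : ∀ u v, r u v → vertexDepth r u < vertexDepth r v := fun u v huv =>
    le_vertexDepth h v (dset_step huv (vertexDepth_mem h u))
  refine ⟨ha, ?_⟩
  intro v m hv
  have hm := vertexDepth_mem h v
  rw [hv] at hm
  obtain ⟨l, hl, hlast, ⟨w, hw, hw'⟩, hlen⟩ := hm
  rcases List.eq_nil_or_concat l with rfl | ⟨l', a, rfl⟩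
  · simp at hlen
  simp only [List.concat_eq_append] at *
  have hav : a = v := by simpa using hlast
  subst hav
  rcases List.eq_nil_or_concat l' with rfl | ⟨l2, u, rfl⟩
  · simp at hlen
  simp only [List.concat_eq_append] at *
  rw [List.isChain_append] at hl
  have hua : r u a := hl.2.2 u (by simp) a (by simp)
  refine ⟨u, hua, ?_⟩
  have h1 : m ∈ dset r u := by
    refine ⟨l2 ++ [u], hl.1, by simp, ⟨w, ?_, hw'⟩, by simpa using hlen⟩
    simpa [List.head?_append] using hw
  have h2 := le_vertexDepth h u h1
  have h3 := ha u a hua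
  omega

/-- A depth function chosen for `r` (when one exists). -/
noncomputable def dep {V : Type} (r : V → V → Prop) : V → ℕ :=
  if h : ∃ d, EDepth r d then h.choose else 0

theorem EDepth.dep_eq {V : Type} {r : V → V → Prop} {d : V → ℕ} (h : EDepth r d) : dep r = d := by
  have hh : ∃ d, EDepth r d := ⟨d, h⟩
  unfold dep
  rw [dif_pos hh]
  exact hh.choose_spec.unique h

/-- Essential DAGs. -/
def EP {V : Type} (r : V → V → Prop) : Prop := IsEssential r ∧ ∃ d, EDepth r d

/-- Vertices of maximum depth. -/
noncomputable def etop {V : Type} [Fintype V] (r : V → V → Prop) : Finset V :=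
  univ.filter (fun x => ∀ y, dep r y ≤ dep r x)

/-- Number of essential DAGs on `V` with `k` vertices of maximum depth. -/
noncomputable def eE (V : Type) [Fintype V] (k : ℕ) : ℕ :=
  Nat.card {r : V → V → Prop // EP r ∧ (etop r).card = k}

theorem essCount_eq (n k : ℕ) : essCount n k = eE (Fin n) k := by
  unfold essCount eE
  refine Nat.card_congr (Equiv.subtypeEquivRight ?_)
  intro r
  have key : IsAcyclicRel r → Nat.card {x : Fin n // ∀ y, vertexDepth r y ≤ vertexDepth r x}
      = (etop r).card := by
    intro h
    unfold etop
    rw [(vertexDepth_spec h).dep_eq, Nat.card_eq_fintype_card, Fintype.card_subtype]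
    congr
  constructor
  · rintro ⟨h1, h2, h3⟩
    exact ⟨⟨h2, _, vertexDepth_spec h1⟩, by rw [← key h1, h3]⟩
  · rintro ⟨⟨h2, d, hd⟩, h3⟩
    exact ⟨hd.acyclic, h2, by rw [key hd.acyclic, h3]⟩

/-- Pull back a relation along an equivalence. -/
def pull {V W : Type} (e : V ≃ W) (r : W → W → Prop) : V → V → Prop := fun x y => r (e x) (e y)

theorem EDepth.pull {V W : Type} (e : V ≃ W) {r : W → W → Prop} {d : W → ℕ} (h : EDepth r d) :
    EDepth (pull e r) (d ∘ e) := by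
  refine ⟨fun u v huv => h.1 _ _ huv, ?_⟩
  intro v m hv
  obtain ⟨u, hu, hd⟩ := h.2 _ m hv
  exact ⟨e.symm u, by simpa [_root_.pull] using hu, by simpa using hd⟩

theorem EP.pull {V W : Type} (e : V ≃ W) {r : W → W → Prop} (h : EP r) : EP (pull e r) := by
  obtain ⟨h1, d, hd⟩ := h
  refine ⟨?_, _, hd.pull e⟩
  intro u v huv
  obtain ⟨x, hx⟩ := h1 _ _ huv
  refine ⟨e.symm x, ?_⟩
  have : e.symm x ≠ u ↔ x ≠ e u := by
    rw [Ne, Ne, Equiv.symm_apply_eq]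
  simpa only [_root_.pull, Equiv.apply_symm_apply, this] using hx

theorem EP.pull_iff {V W : Type} (e : V ≃ W) {r : W → W → Prop} : EP (_root_.pull e r) ↔ EP r := by
  refine ⟨fun h => ?_, fun h => h.pull e⟩
  have h2 := h.pull e.symm
  have h3 : _root_.pull e.symm (_root_.pull e r) = r := by
    funext x y; simp [_root_.pull]
  rwa [h3] at h2

theorem mem_etop_pull {V W : Type} [Fintype V] [Fintype W] (e : V ≃ W) {r : W → W → Prop}
    (h : EP r) (x : V) : x ∈ etop (pull e r) ↔ e x ∈ etop r := by
  obtain ⟨h1, d, hd⟩ := h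
  simp only [etop, mem_filter, mem_univ, true_and, hd.dep_eq, (hd.pull e).dep_eq,
    Function.comp_apply]
  exact ⟨fun h y => by simpa using h (e.symm y), fun h y => h _⟩

/-- The equivalence on relations. -/
def pullEquiv {V W : Type} (e : V ≃ W) : (W → W → Prop) ≃ (V → V → Prop) where
  toFun := pull e
  invFun := pull e.symm
  left_inv r := by funext x y; simp [pull]
  right_inv r := by funext x y; simp [pull]

theorem eE_congr {V W : Type} [Fintype V] [Fintype W] (e : V ≃ W) (k : ℕ) : eE V k = eE W k := by
  unfold eE
  symm
  refine Nat.card_congr ((pullEquiv e).subtypeEquiv ?_)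
  intro r
  change _ ↔ EP (pull e r) ∧ _
  rw [EP.pull_iff]
  refine and_congr_right fun h => ?_
  have : etop r = (etop (pull e r)).map e.toEmbedding := by
    ext y
    obtain ⟨x, rfl⟩ := e.surjective y
    simp [mem_etop_pull e h]
  rw [this, card_map]; rfl

/-- Extend a relation on `A` by new sinks `B` with prescribed in-neighborhoods. -/
def extRel {A B : Type} (r : A → A → Prop) (S : B → Finset A) : A ⊕ B → A ⊕ B → Prop
  | .inl a, .inl b => r a b
  | .inl a, .inr b => a ∈ S b
  | .inr _, _ => False

/-- Admissible in-neighborhoods. -/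
def Good {A : Type} [Fintype A] (r : A → A → Prop) (S : Finset A) : Prop :=
  (∃ u ∈ S, u ∈ etop r) ∧ ∀ u ∈ S, ¬ ∀ x, r x u ↔ (x ∈ S ∧ x ≠ u)

theorem ext_ess {A B : Type} (r : A → A → Prop) (S : B → Finset A) :
    IsEssential (extRel r S) ↔ IsEssential r ∧ ∀ b, ∀ u ∈ S b, ¬ ∀ x, r x u ↔ (x ∈ S b ∧ x ≠ u) := by
  constructor
  · intro h
    refine ⟨fun u v huv => ?_, fun b u hu => ?_⟩
    · obtain ⟨x | x, hx⟩ := h (.inl u) (.inl v) huv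
      · exact ⟨x, by simpa [extRel] using hx⟩
      · simp [extRel] at hx
    · obtain ⟨x | x, hx⟩ := h (.inl u) (.inr b) hu
      · rw [not_forall]
        exact ⟨x, by simpa only [extRel, ne_eq, Sum.inl.injEq] using hx⟩
      · simp [extRel] at hx
  · rintro ⟨h1, h2⟩ (u | u) (v | v) huv
    · obtain ⟨x, hx⟩ := h1 u v huv
      exact ⟨.inl x, by simpa only [extRel, ne_eq, Sum.inl.injEq] using hx⟩
    · obtain ⟨x, hx⟩ := not_forall.1 (h2 v u huv)
      exact ⟨.inl x, by simpa only [extRel, ne_eq, Sum.inl.injEq] using hx⟩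
    · exact huv.elim
    · exact huv.elim

theorem etop_nonempty {A : Type} [Fintype A] [Nonempty A] (r : A → A → Prop) :
    (etop r).Nonempty := by
  obtain ⟨a, -, ha⟩ := exists_max_image (univ : Finset A) (dep r) univ_nonempty
  exact ⟨a, by simpa [etop] using ha⟩

theorem ext_EP {A B : Type} [Fintype A] [Fintype B] [Nonempty A] [Nonempty B]
    (r : A → A → Prop) (S : B → Finset A) :
    (EP (extRel r S) ∧ etop (extRel r S) = univ.map Function.Embedding.inr) ↔
      EP r ∧ ∀ b, Good r (S b) := by
  constructor
  · rintro ⟨⟨h1, d, hd⟩, ht⟩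
    rw [ext_ess] at h1
    have hd' : EDepth r (d ∘ Sum.inl) := by
      refine ⟨fun u v huv => hd.1 (.inl u) (.inl v) huv, fun v m hv => ?_⟩
      obtain ⟨u | u, hu, hm⟩ := hd.2 (.inl v) m hv
      · exact ⟨u, hu, hm⟩
      · exact hu.elim
    refine ⟨⟨h1.1, _, hd'⟩, fun b => ⟨?_, h1.2 b⟩⟩
    have hlt : ∀ a, d (.inl a) < d (.inr b) := by
      intro a
      have hb : (Sum.inr b : A ⊕ B) ∈ etop (extRel r S) := by rw [ht]; simp
      have ha : (Sum.inl a : A ⊕ B) ∉ etop (extRel r S) := by rw [ht]; simp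
      simp only [etop, mem_filter, mem_univ, true_and, hd.dep_eq] at ha hb
      push Not at ha
      obtain ⟨y, hy⟩ := ha
      exact hy.trans_le (hb y)
    obtain ⟨a0⟩ := ‹Nonempty A›
    obtain ⟨m, hm⟩ : ∃ m, d (.inr b) = m + 1 :=
      ⟨d (.inr b) - 1, by have := hlt a0; omega⟩
    obtain ⟨u | u, hu, hum⟩ := hd.2 _ _ hm
    · refine ⟨u, hu, ?_⟩
      simp only [etop, mem_filter, mem_univ, true_and, hd'.dep_eq, Function.comp_apply]
      intro y
      have := hlt y
      omega
    · exact hu.elim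
  · rintro ⟨⟨h1, d, hd⟩, hg⟩
    obtain ⟨a0, ha0⟩ := etop_nonempty r
    simp only [etop, mem_filter, mem_univ, true_and, hd.dep_eq] at ha0
    have hD : EDepth (extRel r S) (Sum.elim d (fun _ => d a0 + 1)) := by
      constructor
      · rintro (u | u) (v | v) huv
        · exact hd.1 _ _ huv
        · simpa [Nat.lt_succ_iff] using ha0 u
        · exact huv.elim
        · exact huv.elim
      · rintro (v | v) m hm
        · obtain ⟨u, hu, hum⟩ := hd.2 v m hm
          exact ⟨.inl u, hu, hum⟩
        · obtain ⟨u, hu, hut⟩ := (hg v).1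
          simp only [etop, mem_filter, mem_univ, true_and, hd.dep_eq] at hut
          refine ⟨.inl u, hu, ?_⟩
          have := hut a0
          have := ha0 u
          simp at hm ⊢
          omega
    refine ⟨⟨(ext_ess r S).2 ⟨h1, fun b => (hg b).2⟩, _, hD⟩, ?_⟩
    obtain ⟨b0⟩ := ‹Nonempty B›
    ext (x | x)
    · simp only [etop, mem_filter, mem_univ, true_and, hD.dep_eq, mem_map]
      simp only [Function.Embedding.inr_apply, reduceCtorEq, exists_false, iff_false, not_forall]
      refine ⟨.inr b0, ?_⟩
      have := ha0 x
      simp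
      omega
    · simp only [etop, mem_filter, mem_univ, true_and, hD.dep_eq, mem_map]
      simp only [Function.Embedding.inr_apply, Sum.inr.injEq, exists_eq, iff_true]
      rintro (y | y)
      · have := ha0 y
        simp; omega
      · simp

theorem top_sink {A B : Type} [Fintype A] [Fintype B] (r : A ⊕ B → A ⊕ B → Prop)
    (h : EP r) (ht : etop r = univ.map Function.Embedding.inr) (b : B) (y : A ⊕ B) :
    ¬ r (.inr b) y := by
  obtain ⟨h1, d, hd⟩ := h
  intro hr
  have hb : (Sum.inr b : A ⊕ B) ∈ etop r := by rw [ht]; simp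
  simp only [etop, mem_filter, mem_univ, true_and, hd.dep_eq] at hb
  have := hb y
  have := hd.1 _ _ hr
  omega

/-- Decomposition of the DAGs whose top set is exactly `B`. -/
noncomputable def decomp {A B : Type} [Fintype A] [Fintype B] [Nonempty A] [Nonempty B] :
    (Σ r : {r : A → A → Prop // EP r}, (B → {S : Finset A // Good r.1 S})) ≃
    {r : A ⊕ B → A ⊕ B → Prop // EP r ∧ etop r = univ.map Function.Embedding.inr} := by
  refine Equiv.ofBijective
    (fun p => ⟨extRel p.1.1 (fun b => (p.2 b).1), (ext_EP _ _).2 ⟨p.1.2, fun b => (p.2 b).2⟩⟩) ⟨?_, ?_⟩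
  · rintro ⟨⟨r, hr⟩, S⟩ ⟨⟨r', hr'⟩, S'⟩ h
    simp only [Subtype.mk.injEq] at h
    have e1 : r = r' := by
      funext a b
      exact congrFun (congrFun h (.inl a)) (.inl b)
    subst e1
    have e2 : S = S' := by
      funext b
      apply Subtype.ext
      ext a
      exact iff_of_eq (congrFun (congrFun h (.inl a)) (.inr b))
    rw [e2]
  · rintro ⟨r, hr⟩
    have e : r = extRel (fun a b => r (.inl a) (.inl b))
        (fun b => univ.filter fun a => r (.inl a) (.inr b)) := by
      funext x y
      rcases x with x | x
      · rcases y with y | y <;> simp [extRel]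
      · simpa [extRel] using top_sink r hr.1 hr.2 x y
    have hr2 := hr
    rw [e, ext_EP] at hr2
    exact ⟨⟨⟨_, hr2.1⟩, fun b => ⟨_, hr2.2 b⟩⟩, Subtype.ext e.symm⟩

/-- The number of admissible in-neighborhoods. -/
def gnum (a s : ℕ) : ℕ := s * (2 ^ (a - s) - 1) + (2 ^ s - s - 1) * 2 ^ (a - s)

theorem sum_aux (s c : ℕ) (hs : 1 ≤ s) :
    ∑ m ∈ range (s + 1), s.choose m * (if m = 0 then 0 else if m = 1 then 2 ^ c - 1 else 2 ^ c)
      = s * (2 ^ c - 1) + (2 ^ s - s - 1) * 2 ^ c := by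
  obtain ⟨t, rfl⟩ : ∃ t, s = t + 1 := ⟨s - 1, by omega⟩
  have h := Nat.sum_range_choose (t + 1)
  rw [sum_range_succ', sum_range_succ'] at h ⊢
  simp only [Nat.choose_zero_right, zero_add, Nat.choose_one_right] at h ⊢
  have h2 : 2 ^ (t + 1) - (t + 1) - 1 = ∑ k ∈ range t, (t + 1).choose (k + 1 + 1) := by omega
  rw [h2, sum_mul]
  simp [add_comm]

theorem good_card {A : Type} [Fintype A] [Nonempty A] (r : A → A → Prop) (h : EP r) :
    Nat.card {S : Finset A // Good r S} = gnum (Fintype.card A) (etop r).card := by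
  obtain ⟨h1, d, hd⟩ := h
  set M := etop r with hM
  have hMN : ∀ u v, r u v → u ∉ M := by
    intro u v huv hu
    simp only [hM, etop, mem_filter, mem_univ, true_and, hd.dep_eq] at hu
    have := hu v
    have := hd.1 _ _ huv
    omega
  have hpos : 1 ≤ M.card := (etop_nonempty r).card_pos
  let N : A → Finset A := fun u => univ.filter fun x => r x u
  let Q : Finset A → Finset (Finset A) := fun X =>
    (Mᶜ).powerset.filter fun Y => X ≠ ∅ ∧ ∀ u, X = {u} → Y ≠ N u
  have hQ : ∀ X ∈ M.powerset, (Q X).card =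
      if X.card = 0 then 0 else if X.card = 1 then 2 ^ (Mᶜ).card - 1 else 2 ^ (Mᶜ).card := by
    intro X hX
    split_ifs with h0 h1
    · rw [card_eq_zero] at h0
      simp [Q, h0]
    · obtain ⟨u, rfl⟩ := card_eq_one.1 h1
      have : Q {u} = (Mᶜ).powerset.erase (N u) := by
        ext Y
        simp [Q, and_comm]
      rw [this, card_erase_of_mem, card_powerset]
      simp only [mem_powerset, N]
      intro x hx
      simp only [mem_filter, mem_univ, true_and] at hx
      simpa using hMN _ _ hx
    · have : Q X = (Mᶜ).powerset := by
        refine filter_true_of_mem fun Y _ => ⟨?_, ?_⟩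
        · rintro rfl; simp at h0
        · rintro u rfl; simp at h1
      rw [this, card_powerset]
  have hgood : ∀ S, Good r S ↔ S ∩ M ≠ ∅ ∧ ∀ u, S ∩ M = {u} → S ∩ Mᶜ ≠ N u := by
    intro S
    unfold Good
    rw [← hM]
    constructor
    · rintro ⟨⟨u, hu, huM⟩, h2⟩
      refine ⟨fun h => ?_, fun w hw hN => ?_⟩
      · have : u ∈ S ∩ M := by simp [hu, huM]
        simp [h] at this
      · have hwS : w ∈ S ∩ M := by simp [hw]
        refine h2 w (mem_inter.1 hwS).1 fun x => ?_
        have e1 : r x w ↔ x ∈ S ∧ x ∉ M := by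
          have : x ∈ S ∩ Mᶜ ↔ x ∈ N w := by rw [hN]
          simpa [N] using this.symm
        rw [e1]
        have e2 : x ∈ S ∧ x ∈ M ↔ x = w := by
          have : x ∈ S ∩ M ↔ x ∈ ({w} : Finset A) := by rw [hw]
          simpa using this
        tauto
    · rintro ⟨h2, h3⟩
      obtain ⟨w, hw⟩ := nonempty_iff_ne_empty.2 h2
      rw [mem_inter] at hw
      refine ⟨⟨w, hw⟩, fun u hu hx => ?_⟩
      have hsub : ∀ y, y ∈ S → y ∈ M → y = u := by
        intro y hy hyM
        by_contra hne
        exact hMN _ _ ((hx y).2 ⟨hy, hne⟩) hyM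
      have hwu := hsub w hw.1 hw.2
      subst hwu
      refine h3 w ?_ ?_
      · ext y
        simp only [mem_inter, mem_singleton]
        exact ⟨fun h => hsub y h.1 h.2, fun h => h ▸ hw⟩
      · ext y
        simp only [mem_inter, mem_compl, N, mem_filter, mem_univ, true_and, hx]
        refine and_congr_right fun hy => ⟨?_, ?_⟩
        · rintro hyM rfl; exact hyM hw.2
        · intro hne hyM; exact hne (hsub y hy hyM)
  have hcard : Nat.card {S : Finset A // Good r S} = (M.powerset.sigma Q).card := by
    rw [Nat.card_eq_fintype_card, Fintype.card_subtype]
    refine card_bij' (fun S _ => ⟨S ∩ M, S ∩ Mᶜ⟩) (fun p _ => p.1 ∪ p.2) ?_ ?_ ?_ ?_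
    · intro S hS
      simp only [mem_filter, mem_univ, true_and, hgood] at hS
      simp only [mem_sigma, mem_powerset, Q, mem_filter]
      exact ⟨inter_subset_right, inter_subset_right, hS⟩
    · rintro ⟨X, Y⟩ hp
      simp only [mem_sigma, mem_powerset, Q, mem_filter] at hp
      obtain ⟨hX, hY, hp⟩ := hp
      simp only [mem_filter, mem_univ, true_and, hgood]
      have e1 : (X ∪ Y) ∩ M = X := by
        ext x; have := @hX x; have := @hY x; simp at *; tauto
      have e2 : (X ∪ Y) ∩ Mᶜ = Y := by
        ext x; have := @hX x; have := @hY x; simp at *; tauto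
      rw [e1, e2]; exact hp
    · intro S _
      ext x; simp; tauto
    · rintro ⟨X, Y⟩ hp
      simp only [mem_sigma, mem_powerset, Q, mem_filter] at hp
      obtain ⟨hX, hY, hp⟩ := hp
      have e1 : (X ∪ Y) ∩ M = X := by
        ext x; have := @hX x; have := @hY x; simp at *; tauto
      have e2 : (X ∪ Y) ∩ Mᶜ = Y := by
        ext x; have := @hX x; have := @hY x; simp at *; tauto
      simp only [e1, e2]
  rw [hcard, card_sigma, sum_congr rfl hQ,
    sum_powerset_apply_card (fun m => if m = 0 then 0 else if m = 1 then 2 ^ (Mᶜ).card - 1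
      else 2 ^ (Mᶜ).card)]
  simp only [smul_eq_mul]
  rw [sum_aux _ _ hpos, gnum, card_compl]

theorem sum_count {A B : Type} [Fintype A] [Fintype B] [Nonempty A] [Nonempty B] :
    Nat.card {r : A ⊕ B → A ⊕ B → Prop // EP r ∧ etop r = univ.map Function.Embedding.inr} =
      ∑ s ∈ Icc 1 (Fintype.card A), eE A s * gnum (Fintype.card A) s ^ Fintype.card B := by
  rw [← Nat.card_congr decomp, Nat.card_sigma]
  have : ∀ r : {r : A → A → Prop // EP r}, Nat.card (B → {S : Finset A // Good r.1 S}) =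
      gnum (Fintype.card A) (etop r.1).card ^ Fintype.card B := by
    intro r
    rw [Nat.card_fun, good_card r.1 r.2, Nat.card_eq_fintype_card]
  simp only [this]
  rw [← sum_fiberwise_of_maps_to (s := univ) (t := Icc 1 (Fintype.card A))
    (g := fun r : {r : A → A → Prop // EP r} => (etop r.1).card)]
  · refine sum_congr rfl fun s _ => ?_
    rw [sum_congr rfl (g := fun _ => gnum (Fintype.card A) s ^ Fintype.card B)]
    · rw [sum_const, smul_eq_mul]
      congr 1
      unfold eE
      rw [← Fintype.card_subtype, ← Nat.card_eq_fintype_card]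
      exact Nat.card_congr (Equiv.subtypeSubtypeEquivSubtypeInter _ (fun r => (etop r).card = s))
    · intro r hr
      simp only [mem_filter, mem_univ, true_and] at hr
      rw [hr]
  · intro r _
    rw [mem_Icc]
    exact ⟨(etop_nonempty r.1).card_pos, card_le_univ _⟩

theorem top_count (n k : ℕ) (h1 : 1 ≤ k) (h2 : k < n) (T : Finset (Fin n)) (hT : T.card = k) :
    Nat.card {r : Fin n → Fin n → Prop // EP r ∧ etop r = T} =
      ∑ s ∈ Icc 1 (n - k), eE (Fin (n - k)) s * gnum (n - k) s ^ k := by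
  have cT : Fintype.card {x // x ∈ T} = k := by simpa using hT
  have cT' : Fintype.card {x // ¬ x ∈ T} = n - k := by
    rw [Fintype.card_subtype_compl, cT, Fintype.card_fin]
  let e1 : Fin (n - k) ≃ {x // ¬ x ∈ T} := (Fintype.equivFinOfCardEq cT').symm
  let e2 : Fin k ≃ {x // x ∈ T} := (Fintype.equivFinOfCardEq cT).symm
  let e : Fin (n - k) ⊕ Fin k ≃ Fin n :=
    (Equiv.sumComm _ _).trans ((Equiv.sumCongr e2 e1).trans (Equiv.sumCompl (fun x => x ∈ T)))
  have : Nonempty (Fin k) := ⟨⟨0, by omega⟩⟩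
  have : Nonempty (Fin (n - k)) := ⟨⟨0, by omega⟩⟩
  have key := sum_count (A := Fin (n - k)) (B := Fin k)
  simp only [Fintype.card_fin] at key
  rw [← key]
  refine Nat.card_congr ((pullEquiv e).subtypeEquiv ?_)
  intro r
  change _ ↔ EP (pull e r) ∧ etop (pull e r) = _
  rw [EP.pull_iff]
  refine and_congr_right fun h => ?_
  have hl : ∀ a, e (.inl a) ∉ T := fun a => by simpa [e] using (e1 a).2
  have hr : ∀ b, e (.inr b) ∈ T := fun b => by simpa [e] using (e2 b).2
  constructor
  · intro ht
    ext (x | x)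
    · rw [mem_etop_pull e h, ht]; simp [hl]
    · rw [mem_etop_pull e h, ht]; simp [hr]
  · intro ht
    ext y
    obtain ⟨x, rfl⟩ := e.surjective y
    rw [← mem_etop_pull e h, ht]
    rcases x with x | x
    · simp [hl]
    · simp [hr]

theorem eE_rec (n k : ℕ) (h1 : 1 ≤ k) (h2 : k < n) :
    eE (Fin n) k = n.choose k *
      ∑ s ∈ Icc 1 (n - k), eE (Fin (n - k)) s * gnum (n - k) s ^ k := by
  have e : {r : Fin n → Fin n → Prop // EP r ∧ (etop r).card = k} ≃
      Σ T : {T : Finset (Fin n) // T.card = k},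
        {r : Fin n → Fin n → Prop // EP r ∧ etop r = T.1} :=
    { toFun := fun r => ⟨⟨etop r.1, r.2.2⟩, ⟨r.1, r.2.1, rfl⟩⟩
      invFun := fun p => ⟨p.2.1, p.2.2.1, by rw [p.2.2.2]; exact p.1.2⟩
      left_inv := fun r => rfl
      right_inv := by
        rintro ⟨⟨T, hT⟩, ⟨r, hr, ht⟩⟩
        change etop r = T at ht
        subst ht
        rfl }
  unfold eE
  rw [Nat.card_congr e, Nat.card_sigma,
    sum_congr rfl (fun T _ => top_count n k h1 h2 T.1 T.2), sum_const, smul_eq_mul]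
  congr 1
  rw [card_univ, Fintype.card_finset_len, Fintype.card_fin]

theorem eE_self (m : ℕ) (hm : 1 ≤ m) : eE (Fin m) m = 1 := by
  unfold eE
  rw [Nat.card_eq_one_iff_unique]
  have hz : EDepth (fun _ _ : Fin m => False) (fun _ => 0) :=
    ⟨fun _ _ h => h.elim, fun v m h => by simp at h⟩
  constructor
  · have key : ∀ r : Fin m → Fin m → Prop, EP r ∧ (etop r).card = m → r = fun _ _ => False := by
      rintro r ⟨⟨-, d, hd⟩, hc⟩
      have hu : etop r = univ := by
        rw [← card_eq_iff_eq_univ, hc, Fintype.card_fin]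
      funext x y
      refine eq_false fun hr => ?_
      have hx : x ∈ etop r := by rw [hu]; simp
      simp only [etop, mem_filter, mem_univ, true_and, hd.dep_eq] at hx
      have := hx y
      have := hd.1 _ _ hr
      omega
    exact ⟨fun a b => Subtype.ext ((key _ a.2).trans (key _ b.2).symm)⟩
  · refine ⟨⟨fun _ _ => False, ⟨fun _ _ h => h.elim, _, hz⟩, ?_⟩⟩
    simp [etop, hz.dep_eq]

end Helpers

/-- The counting recurrence for labeled essential DAGs by number of vertices of
maximum depth. -/
theorem stmt_17 (n k : ℕ) (h1 : 1 ≤ k) (h2 : k < n) :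
    (∀ m, 1 ≤ m → essCount m m = 1) ∧
    essCount n k =
      n.choose k *
        ∑ s ∈ Finset.Icc 1 (n - k),
          essCount (n - k) s *
            (s * (2 ^ (n - k - s) - 1) + (2 ^ s - s - 1) * 2 ^ (n - k - s)) ^ k := by
  simp only [essCount_eq]
  exact ⟨eE_self, eE_rec n k h1 h2⟩
end
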